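/- For every finite connected simple port-labeled graph G with n vertices, every root vertex v_R, and every integer k with 2 ≤ k ≤ n: if v ∈ V' ∖ {v_R} is a non-rootpath vertex, then during the k-stopped port-DFS traversal the walk leaves v via its parent port par(v) exactly once. -/

import Mathlib

open scoped Classical

/-- Direction of a move of the port-DFS traversal. -/
inductive PDir : Type where
  | fwd : PDir
  | bwd : PDir
deriving DecidableEq

/-- Position of the port-DFS walk: before the first move (`start`, at the root),
having just arrived at `cur` via in-port `inPort` with direction `dir` (`moving`),
or halted at a vertex. -/
inductive PPos (V : Type) : Type where
  | start : PPos V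
  | moving : V → ℕ → PDir → PPos V
  | halted : V → PPos V

/-- Full state of the port-DFS traversal: position, set `S` of visited vertices,
and parent-port assignment `par`. -/
structure PState (V : Type) : Type where
  pos : PPos V
  vis : Finset V
  par : V → ℕ

/-- A finite connected simple port-labeled graph: for every vertex `u` of degree
`deg u`, the edges incident to `u` are labeled by distinct ports `0, …, deg u - 1`;
`port u v` is the port at `u` of the edge `{u, v}`. -/
structure PortedGraph (V : Type) [Fintype V] [DecidableEq V] : Type where
  G : SimpleGraph V
  conn : G.Connected
  deg : V → ℕ
  port : V → V → ℕ
  port_lt : ∀ {u v : V}, G.Adj u v → port u v < deg u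
  port_inj : ∀ {u v w : V}, G.Adj u v → G.Adj u w → port u v = port u w → v = w
  port_surj : ∀ {u : V} (p : ℕ), p < deg u → ∃ v : V, G.Adj u v ∧ port u v = p

namespace PortedGraph

variable {V : Type} [Fintype V] [DecidableEq V]

/-- The neighbor of `u` reached from `u` through port `p`. -/
noncomputable def dest (P : PortedGraph V) (u : V) (p : ℕ) : V :=
  if h : ∃ v : V, P.G.Adj u v ∧ P.port u v = p then h.choose else u

/-- One step of the port-DFS traversal from root `vR`.  A state with
`pos = moving v q d` means the walk has just arrived at `v` via port `q` (at `v`)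
with direction `d`, and `vis`/`par` are the data from before processing this
arrival; the step processes the arrival according to rules (i)–(v) and performs
the next move (or halts). -/
noncomputable def step (P : PortedGraph V) (vR : V) (s : PState V) : PState V :=
  match s.pos with
  | PPos.start =>
      if 0 < P.deg vR then
        { pos := PPos.moving (P.dest vR 0) (P.port (P.dest vR 0) vR) PDir.fwd,
          vis := s.vis, par := s.par }
      else
        { pos := PPos.halted vR, vis := s.vis, par := s.par }
  | PPos.halted v => { pos := PPos.halted v, vis := s.vis, par := s.par }
  | PPos.moving v q PDir.fwd =>
      if v ∈ s.vis then
        -- rule (ii): leave via `q` with direction backward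
        { pos := PPos.moving (P.dest v q) (P.port (P.dest v q) v) PDir.bwd,
          vis := s.vis, par := s.par }
      else
        -- rule (i): add `v` to `S`, set `par v := q`, leave via `(q+1) % deg v`
        { pos := PPos.moving (P.dest v ((q + 1) % P.deg v))
            (P.port (P.dest v ((q + 1) % P.deg v)) v)
            (if (q + 1) % P.deg v = q then PDir.bwd else PDir.fwd),
          vis := insert v s.vis, par := Function.update s.par v q }
  | PPos.moving v q PDir.bwd =>
      if v ≠ vR ∧ (q + 1) % P.deg v = s.par v then
        -- rule (iii): leave via the parent port with direction backward
        { pos := PPos.moving (P.dest v (s.par v)) (P.port (P.dest v (s.par v)) v) PDir.bwd,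
          vis := s.vis, par := s.par }
      else if v = vR ∧ (q + 1) % P.deg v = 0 then
        -- rule (iv): halt
        { pos := PPos.halted v, vis := s.vis, par := s.par }
      else
        -- rule (v): leave via `(q+1) % deg v` with direction forward
        { pos := PPos.moving (P.dest v ((q + 1) % P.deg v))
            (P.port (P.dest v ((q + 1) % P.deg v)) v) PDir.fwd,
          vis := s.vis, par := s.par }

/-- The trace of the port-DFS traversal from `vR`:  `trace P vR t` is the state
after `t` transitions; every transition except those into/out of a halted
position is a move along an edge. -/
noncomputable def trace (P : PortedGraph V) (vR : V) : ℕ → PState V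
  | 0 => { pos := PPos.start, vis := {vR}, par := fun _ => 0 }
  | t + 1 => P.step vR (P.trace vR t)

/-- The first time at which `k` distinct vertices have been visited; the
`k`-stopped traversal is the traversal halted at that moment (at which point the
walk, having made `stopTime - 1` moves, stands at the `k`-th visited vertex). -/
noncomputable def stopTime (P : PortedGraph V) (vR : V) (k : ℕ) : ℕ :=
  sInf {t : ℕ | k ≤ ((P.trace vR t).vis).card}

/-- `V'`: the set of vertices visited by the `k`-stopped traversal. -/
noncomputable def visitedBy (P : PortedGraph V) (vR : V) (k : ℕ) : Finset V :=
  (P.trace vR (P.stopTime vR k)).vis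

/-- `V'` as a set. -/
noncomputable def Vset (P : PortedGraph V) (vR : V) (k : ℕ) : Set V :=
  ↑(P.visitedBy vR k)

/-- The parent-port assignment at the end of the `k`-stopped traversal. -/
noncomputable def parFinal (P : PortedGraph V) (vR : V) (k : ℕ) : V → ℕ :=
  (P.trace vR (P.stopTime vR k)).par

/-- `u(v)`: the neighbor of `v` reached from `v` through its parent port. -/
noncomputable def parentVert (P : PortedGraph V) (vR : V) (k : ℕ) (v : V) : V :=
  P.dest v (P.parFinal vR k v)

/-- `v_L`: the `k`-th (last) vertex added to `S` by the `k`-stopped traversal. -/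
noncomputable def lastVert (P : PortedGraph V) (vR : V) (k : ℕ) : V :=
  if h : ∃ v : V, v ∈ P.visitedBy vR k ∧ v ∉ (P.trace vR (P.stopTime vR k - 1)).vis
  then h.choose else vR

/-- The tree `T` of parent edges `{v, u(v)}`, `v ∈ V' \ {v_R}`, as a graph on `V`
(vertices outside `V'` are isolated). -/
noncomputable def treeRel (P : PortedGraph V) (vR : V) (k : ℕ) : SimpleGraph V :=
  SimpleGraph.fromRel (fun a b =>
    a ∈ P.visitedBy vR k ∧ a ≠ vR ∧ b = P.parentVert vR k a)

/-- The tree `T` of parent edges as a graph on the vertex set `V'`. -/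
noncomputable def treeSub (P : PortedGraph V) (vR : V) (k : ℕ) :
    SimpleGraph (P.Vset vR k) :=
  SimpleGraph.fromRel (fun a b => (a : V) ≠ vR ∧ (b : V) = P.parentVert vR k (a : V))

/-- `v` lies on the rootpath: the unique path in `T` from `v_R` to `v_L`. -/
def onRootpath (P : PortedGraph V) (vR : V) (k : ℕ) (v : V) : Prop :=
  ∃ p : (P.treeRel vR k).Walk vR (P.lastVert vR k), p.IsPath ∧ v ∈ p.support

/-- The move made out of state `s`:  `some (v, p, d)` if the walk leaves vertex
`v` via port `p` with direction `d`, and `none` if it halts (or already halted). -/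
noncomputable def exitEvent (P : PortedGraph V) (vR : V) (s : PState V) :
    Option (V × ℕ × PDir) :=
  match s.pos with
  | PPos.start => if 0 < P.deg vR then some (vR, 0, PDir.fwd) else none
  | PPos.halted _ => none
  | PPos.moving v q PDir.fwd =>
      if v ∈ s.vis then some (v, q, PDir.bwd)
      else some (v, (q + 1) % P.deg v,
        if (q + 1) % P.deg v = q then PDir.bwd else PDir.fwd)
  | PPos.moving v q PDir.bwd =>
      if v ≠ vR ∧ (q + 1) % P.deg v = s.par v then some (v, s.par v, PDir.bwd)
      else if v = vR ∧ (q + 1) % P.deg v = 0 then none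
      else some (v, (q + 1) % P.deg v, PDir.fwd)

end PortedGraph

namespace PortedGraph

variable {V : Type} [Fintype V] [DecidableEq V]

lemma dest_port (P : PortedGraph V) {u v : V} (h : P.G.Adj u v) :
    P.dest u (P.port u v) = v := by
  have hex : ∃ w : V, P.G.Adj u w ∧ P.port u w = P.port u v := ⟨v, h, rfl⟩
  rw [dest, dif_pos hex]
  exact P.port_inj hex.choose_spec.1 h hex.choose_spec.2

lemma exists_dest (P : PortedGraph V) {u : V} {p : ℕ} (hp : p < P.deg u) :
    ∃ w : V, P.G.Adj u w ∧ P.port u w = p ∧ P.dest u p = w := by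
  obtain ⟨w, hw, rfl⟩ := P.port_surj p hp
  exact ⟨w, hw, rfl, P.dest_port hw⟩

/-- The number of ports between `b` and `p` in the cyclic order of `d` ports. -/
def cyclicRank (d b p : ℕ) : ℕ := if b ≤ p then p - b else p + d - b

lemma cyclicRank_lt_succ {d b p : ℕ} (hb : b < d) (hp : p < d) (h : (p + 1) % d ≠ b) :
    cyclicRank d b p < cyclicRank d b ((p + 1) % d) := by
  have : (p + 1) % d = if p + 1 = d then 0 else p + 1 := by
    split_ifs with hd
    · rw [hd, Nat.mod_self]
    · exact Nat.mod_eq_of_lt (by omega)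
  rw [this] at h ⊢
  unfold cyclicRank
  split_ifs at h ⊢ <;> omega

/-- `w` has parent `a` with respect to the parent ports `f`. -/
def IsParent (P : PortedGraph V) (f : V → ℕ) (w a : V) : Prop :=
  P.G.Adj w a ∧ f w = P.port w a

lemma IsParent.unique {P : PortedGraph V} {f : V → ℕ} {w a b : V}
    (ha : P.IsParent f w a) (hb : P.IsParent f w b) : a = b :=
  P.port_inj ha.1 hb.1 (ha.2.symm.trans hb.2)

/-- The position of port `p` in the order in which `a` explores its ports. -/
def rank (P : PortedGraph V) (f : V → ℕ) (a : V) (p : ℕ) : ℕ :=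
  cyclicRank (P.deg a) (f a) p

/-- The list of active vertices of the traversal, deepest vertex first: each one is a child
of the next, and is the last child of it visited so far. -/
inductive IsStack (P : PortedGraph V) (vR : V) (f : V → ℕ) (S : Finset V) : List V → Prop
  | root : vR ∈ S → IsStack P vR f S [vR]
  | cons {a c : V} {l : List V} : IsStack P vR f S (a :: l) → c ≠ vR → c ∈ S →
      P.IsParent f c a → c ∉ a :: l →
      (∀ v ∈ S, v ≠ vR → P.IsParent f v a →
        P.rank f a (P.port a v) ≤ P.rank f a (P.port a c)) →
      IsStack P vR f S (c :: a :: l)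

namespace IsStack

variable {P : PortedGraph V} {vR : V} {f : V → ℕ} {S : Finset V} {l : List V}

lemma mem_of_mem (h : P.IsStack vR f S l) : ∀ v ∈ l, v ∈ S := by
  induction h with
  | root h => simpa using h
  | cons _ _ hc _ _ _ ih =>
    intro v hv
    rcases List.mem_cons.1 hv with rfl | hv
    exacts [hc, ih v hv]

lemma nodup (h : P.IsStack vR f S l) : l.Nodup := by
  induction h with
  | root => simp
  | cons _ _ _ _ hn _ ih => exact List.nodup_cons.2 ⟨hn, ih⟩

lemma insert (h : P.IsStack vR f S l) {w : V} (hw : ∀ a ∈ l.tail, ¬ P.IsParent f w a) :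
    P.IsStack vR f (insert w S) l := by
  induction h with
  | root h => exact .root (Finset.mem_insert_of_mem h)
  | @cons a c l _ hne hc hp hn hr ih =>
    refine .cons (ih fun b hb => hw b (List.mem_cons_of_mem _ hb)) hne
      (Finset.mem_insert_of_mem hc) hp hn fun v hv hv' hva => ?_
    rcases Finset.mem_insert.1 hv with rfl | hv
    · exact absurd hva (hw a (by simp))
    · exact hr v hv hv' hva

lemma insert_of_isParent {a w : V} (h : P.IsStack vR f S (a :: l)) (hw : P.IsParent f w a) :
    P.IsStack vR f (Insert.insert w S) (a :: l) := by
  refine h.insert fun b hb hwb => ?_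
  cases hw.unique hwb
  exact (List.nodup_cons.1 h.nodup).1 hb

lemma exists_walk {T : SimpleGraph V} (h : P.IsStack vR f S l)
    (hT : ∀ w ∈ S, w ≠ vR → ∀ a, P.IsParent f w a → T.Adj w a) {a : V} (ha : l.head? = some a) :
    ∃ p : T.Walk a vR, p.support = l := by
  induction h generalizing a with
  | root =>
    obtain rfl : vR = a := by simpa using ha
    exact ⟨.nil, rfl⟩
  | @cons b c l _ hne hc hp _ _ ih =>
    obtain rfl : c = a := by simpa using ha
    obtain ⟨p, hps⟩ := ih (a := b) rfl
    exact ⟨.cons (hT _ hc hne _ hp) p, by simp [hps]⟩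

end IsStack

/-- The part of the invariant of the traversal that concerns the position of the walk:
`l` is the stack of active vertices. -/
def PosInv (P : PortedGraph V) (vR : V) (f : V → ℕ) (S : Finset V) : PPos V → List V → Prop
  | .moving w q .fwd, l => ∃ a, l.head? = some a ∧ P.G.Adj w a ∧ q = P.port w a ∧
      ∀ v ∈ S, v ≠ vR → P.IsParent f v a → P.rank f a (P.port a v) < P.rank f a (P.port a w)
  | .moving a q .bwd, l => l.head? = some a ∧ q < P.deg a ∧
      ∀ v ∈ S, v ≠ vR → P.IsParent f v a → P.rank f a (P.port a v) ≤ P.rank f a q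
  | .start, l => l = [vR] ∧ S = {vR}
  | .halted _, _ => False

/-- The invariant of the traversal before it halts: `l` is the stack of active vertices, and
`c v` counts the exits from `v` via its parent port `f v` so far. -/
structure TraversalInv (P : PortedGraph V) (vR : V) (f c : V → ℕ) (s : PState V)
    (l : List V) : Prop where
  stack : P.IsStack vR f s.vis l
  par_eq : ∀ v ∈ s.vis, s.par v = f v
  exists_parent : ∀ v ∈ s.vis, v ≠ vR → ∃ a ∈ s.vis, P.IsParent f v a
  count : ∀ v, v ≠ vR → c v = if v ∈ s.vis ∧ v ∉ l then 1 else 0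
  pos : P.PosInv vR f s.vis s.pos l

/-- The walk moves out of state `s` from `v` via port `f v`. -/
def ExitsVia (P : PortedGraph V) (vR : V) (f : V → ℕ) (s : PState V) (v : V) : Prop :=
  ∃ d : PDir, P.exitEvent vR s = some (v, f v, d)

lemma TraversalInv.step {P : PortedGraph V} {vR : V} {f c : V → ℕ} {s : PState V} {l : List V}
    (h : P.TraversalInv vR f c s l) (hroot : f vR = 0)
    (hpar : ∀ v ∈ (P.step vR s).vis, (P.step vR s).par v = f v) :
    (∃ x, (P.step vR s).pos = .halted x) ∨
      ∃ l', P.TraversalInv vR f (fun v => c v + if P.ExitsVia vR f s v then 1 else 0)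
        (P.step vR s) l' := by
  obtain ⟨hstack, hpe, hex, hc, hpos⟩ := h
  obtain ⟨pos, S, par⟩ := s
  dsimp only at *
  match pos, hpos with
  | .start, hpos =>
    obtain ⟨rfl, rfl⟩ := hpos
    by_cases hd : 0 < P.deg vR
    · right
      obtain ⟨w, hw, hp, hdest⟩ := P.exists_dest hd
      refine ⟨[vR], ?_⟩
      simp only [PortedGraph.step, if_pos hd, hdest] at hpar ⊢
      refine ⟨hstack, hpar, hex, fun v hv => ?_, ⟨vR, rfl, hw.symm, rfl, ?_⟩⟩
      · simp [hc v hv, ExitsVia, exitEvent, hd, hv.symm]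
      · intro v hv hv'
        exact absurd (Finset.mem_singleton.1 hv) hv'
    · left
      exact ⟨vR, by simp [PortedGraph.step, hd]⟩
  | .moving w q .fwd, hpos =>
    right
    obtain ⟨a, hl, hwa, rfl, hr⟩ := hpos
    obtain ⟨l, rfl⟩ : ∃ l', l = a :: l' := by
      cases l <;> simp_all
    have haS : a ∈ S := hstack.mem_of_mem a (by simp)
    by_cases hw : w ∈ S
    · refine ⟨a :: l, ?_⟩
      simp only [PortedGraph.step, if_pos hw, P.dest_port hwa] at hpar ⊢
      refine ⟨hstack, hpar, hex, fun v hv => ?_, rfl, P.port_lt hwa.symm,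
        fun v hv hv' hva => (hr v hv hv' hva).le⟩
      have : ¬ P.ExitsVia vR f ⟨.moving w (P.port w a) .fwd, S, par⟩ v := by
        rintro ⟨d, hd⟩
        simp only [exitEvent, if_pos hw, Option.some.injEq, Prod.mk.injEq] at hd
        obtain ⟨rfl, hq, -⟩ := hd
        exact lt_irrefl _ (hr w hw hv ⟨hwa, hq.symm⟩)
      simp [this, hc v hv]
    · have hwne : w ≠ vR := by
        rintro rfl
        refine hw ?_
        clear * - hstack
        generalize a :: l = m at hstack
        induction hstack with
        | root h => exact h
        | cons _ _ _ _ _ _ ih => exact ih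
      have hfw : f w = P.port w a := by
        rw [← hpar w (by simp [PortedGraph.step, hw])]
        simp [PortedGraph.step, hw]
      have hpw : P.IsParent f w a := ⟨hwa, hfw⟩
      have hwl : w ∉ a :: l := fun h => hw (hstack.mem_of_mem w h)
      have hstack' := hstack.insert_of_isParent hpw
      have hex' : ∀ v ∈ insert w S, v ≠ vR → ∃ a ∈ insert w S, P.IsParent f v a := by
        intro v hv hv'
        rcases Finset.mem_insert.1 hv with rfl | hv
        · exact ⟨a, Finset.mem_insert_of_mem haS, hpw⟩
        · obtain ⟨b, hb, hvb⟩ := hex v hv hv'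
          exact ⟨b, Finset.mem_insert_of_mem hb, hvb⟩
      have hr' : ∀ v ∈ insert w S, v ≠ vR → P.IsParent f v a →
          P.rank f a (P.port a v) ≤ P.rank f a (P.port a w) := by
        intro v hv hv' hva
        rcases Finset.mem_insert.1 hv with rfl | hv
        · exact le_rfl
        · exact (hr v hv hv' hva).le
      by_cases hq : (P.port w a + 1) % P.deg w = P.port w a
      · refine ⟨a :: l, ?_⟩
        simp only [PortedGraph.step, if_neg hw, hq, if_true, P.dest_port hwa] at hpar ⊢
        refine ⟨hstack', hpar, hex', fun v hv => ?_, rfl, P.port_lt hwa.symm, hr'⟩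
        by_cases hvw : v = w
        · subst hvw
          have : P.ExitsVia vR f ⟨.moving v (P.port v a) .fwd, S, par⟩ v :=
            ⟨.bwd, by simp [exitEvent, hw, hq, hfw]⟩
          simp only [hc v hv, hw, this, hwl, Finset.mem_insert_self]
          simp
        · have : ¬ P.ExitsVia vR f ⟨.moving w (P.port w a) .fwd, S, par⟩ v := by
            rintro ⟨d, hd⟩
            simp only [exitEvent, if_neg hw, Option.some.injEq, Prod.mk.injEq] at hd
            exact hvw hd.1.symm
          simp [this, hc v hv, hvw]
      · refine ⟨w :: a :: l, ?_⟩
        obtain ⟨x, hx, hp, hdest⟩ := P.exists_dest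
          (Nat.mod_lt (P.port w a + 1) ((Nat.zero_le _).trans_lt (P.port_lt hwa)))
        simp only [PortedGraph.step, if_neg hw, if_neg hq, hdest] at hpar ⊢
        refine ⟨.cons hstack' hwne (Finset.mem_insert_self _ _) hpw hwl hr', hpar, hex',
          fun v hv => ?_, w, rfl, hx.symm, rfl, ?_⟩
        · have : ¬ P.ExitsVia vR f ⟨.moving w (P.port w a) .fwd, S, par⟩ v := by
            rintro ⟨d, hd⟩
            simp only [exitEvent, if_neg hw, Option.some.injEq, Prod.mk.injEq] at hd
            obtain ⟨rfl, hq', -⟩ := hd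
            exact hq (hq'.trans hfw)
          by_cases hvw : v = w
          · subst hvw
            simp [this, hc v hv, hw]
          · simp [this, hc v hv, hvw]
        · intro v hv hv' hvw
          rcases Finset.mem_insert.1 hv with rfl | hv
          · exact absurd hvw.1 (P.G.irrefl)
          · obtain ⟨b, hb, hvb⟩ := hex v hv hv'
            exact absurd (hvw.unique hvb ▸ hb) hw
  | .moving a q .bwd, hpos =>
    obtain ⟨hl, hq, hr⟩ := hpos
    obtain ⟨l, rfl⟩ : ∃ l', l = a :: l' := by
      cases l <;> simp_all
    have haS : a ∈ S := hstack.mem_of_mem a (by simp)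
    have hpa : par a = f a := hpe a haS
    by_cases h1 : a ≠ vR ∧ (q + 1) % P.deg a = f a
    · right
      cases hstack with
      | root => exact absurd rfl h1.1
      | @cons b _ l hstack _ _ hp hn hr' =>
        refine ⟨b :: l, ?_⟩
        have hdest : P.dest a (f a) = b := by rw [hp.2, P.dest_port hp.1]
        simp only [PortedGraph.step, hpa, if_pos h1, hdest] at hpar ⊢
        refine ⟨hstack, hpar, hex, fun v hv => ?_, rfl, P.port_lt hp.1.symm, hr'⟩
        by_cases hva : v = a
        · subst hva
          have : P.ExitsVia vR f ⟨.moving v q .bwd, S, par⟩ v :=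
            ⟨.bwd, by simp [exitEvent, hpa, h1]⟩
          simp only [this, hc v hv, haS, hn]
          simp
        · have : ¬ P.ExitsVia vR f ⟨.moving a q .bwd, S, par⟩ v := by
            rintro ⟨d, hd⟩
            simp only [exitEvent, hpa, if_pos h1, Option.some.injEq, Prod.mk.injEq] at hd
            exact hva hd.1.symm
          simp [this, hc v hv, hva]
    · by_cases h2 : a = vR ∧ (q + 1) % P.deg a = 0
      · left
        exact ⟨a, by simp only [PortedGraph.step, hpa, if_neg h1, if_pos h2]⟩
      · right
        have hne : (q + 1) % P.deg a ≠ f a := by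
          intro h
          by_cases har : a = vR
          · exact h2 ⟨har, by rw [h, har, hroot]⟩
          · exact h1 ⟨har, h⟩
        have hfa : f a < P.deg a := by
          by_cases har : a = vR
          · rw [har, hroot, ← har]
            exact (Nat.zero_le _).trans_lt hq
          · obtain ⟨b, -, hab⟩ := hex a haS har
            exact hab.2 ▸ P.port_lt hab.1
        refine ⟨a :: l, ?_⟩
        obtain ⟨x, hx, hp, hdest⟩ := P.exists_dest
          (Nat.mod_lt (q + 1) ((Nat.zero_le _).trans_lt hq))
        simp only [PortedGraph.step, hpa, if_neg h1, if_neg h2, hdest] at hpar ⊢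
        refine ⟨hstack, hpar, hex, fun v hv => ?_, a, rfl, hx.symm, rfl, ?_⟩
        · have : ¬ P.ExitsVia vR f ⟨.moving a q .bwd, S, par⟩ v := by
            rintro ⟨d, hd⟩
            simp only [exitEvent, hpa, if_neg h1, if_neg h2, Option.some.injEq,
              Prod.mk.injEq] at hd
            obtain ⟨rfl, hq', -⟩ := hd
            exact hne hq'
          simp [this, hc v hv]
        · intro v hv hv' hva
          rw [hp]
          exact (hr v hv hv' hva).trans_lt (cyclicRank_lt_succ hfa hq hne)

lemma step_vis_par (P : PortedGraph V) (vR : V) (s : PState V) {v : V} (hv : v ∈ s.vis) :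
    v ∈ (P.step vR s).vis ∧ (P.step vR s).par v = s.par v := by
  obtain ⟨pos, S, par⟩ := s
  dsimp only at hv
  match pos with
  | .start => unfold step; dsimp only; split_ifs <;> exact ⟨hv, rfl⟩
  | .halted _ => exact ⟨hv, rfl⟩
  | .moving w q .bwd => unfold step; dsimp only; split_ifs <;> exact ⟨hv, rfl⟩
  | .moving w q .fwd =>
    by_cases hw : w ∈ S
    · simp [step, hw, hv]
    · have : v ≠ w := fun h => hw (h ▸ hv)
      simp [step, hw, hv, this]

lemma trace_vis_par (P : PortedGraph V) (vR : V) {s t : ℕ} (hst : s ≤ t) {v : V}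
    (hv : v ∈ (P.trace vR s).vis) :
    v ∈ (P.trace vR t).vis ∧ (P.trace vR t).par v = (P.trace vR s).par v := by
  induction t, hst using Nat.le_induction with
  | base => exact ⟨hv, rfl⟩
  | succ t _ ih =>
    have := P.step_vis_par vR (P.trace vR t) ih.1
    exact ⟨this.1, this.2.trans ih.2⟩

/-- A step that visits a new vertex is an application of rule (i). -/
lemma exists_pos_of_step_vis_ne (P : PortedGraph V) (vR : V) (s : PState V)
    (h : (P.step vR s).vis ≠ s.vis) :
    ∃ w q, s.pos = .moving w q .fwd ∧ w ∉ s.vis ∧ (P.step vR s).vis = insert w s.vis ∧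
      (P.step vR s).par w = q := by
  obtain ⟨pos, S, par⟩ := s
  match pos with
  | .start => revert h; unfold step; dsimp only; split_ifs <;> simp
  | .halted _ => exact absurd rfl h
  | .moving w q .bwd => revert h; unfold step; dsimp only; split_ifs <;> simp
  | .moving w q .fwd =>
    by_cases hw : w ∈ S
    · simp [step, hw] at h
    · exact ⟨w, q, rfl, hw, by simp [step, hw], by simp [step, hw]⟩

/-- The invariant holds at every time up to `N`, the parent ports being those at time `N`. -/
lemma exists_traversalInv (P : PortedGraph V) (vR : V) {f : V → ℕ} {N : ℕ}
    (hf : f = (P.trace vR N).par) {t : ℕ} (ht : t ≤ N) :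
    (∃ x, (P.trace vR t).pos = .halted x) ∨
      ∃ l, P.TraversalInv vR f
        (fun v => ((Finset.range t).filter fun s => P.ExitsVia vR f (P.trace vR s) v).card)
        (P.trace vR t) l := by
  have hpar : ∀ t ≤ N, ∀ v ∈ (P.trace vR t).vis, (P.trace vR t).par v = f v := by
    intro t ht v hv
    rw [hf, (P.trace_vis_par vR ht hv).2]
  induction t with
  | zero =>
    refine .inr ⟨[vR], .root (by simp [trace]), hpar 0 ht, ?_, ?_, rfl, rfl⟩
    · intro v hv hv'
      exact absurd (by simpa [trace] using hv) hv'
    · intro v hv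
      simp [trace, hv]
  | succ t ih =>
    rcases ih (by omega) with ⟨x, hx⟩ | ⟨l, hl⟩
    · exact .inl ⟨x, by simp [trace, step, hx]⟩
    · have hroot : f vR = 0 := by
        rw [← hpar 0 (Nat.zero_le _) vR (by simp [trace])]
        rfl
      have := hl.step hroot (hpar (t + 1) ht)
      refine this.imp id fun ⟨l', hl'⟩ => ⟨l', ?_⟩
      rw [trace]
      convert hl' using 2 with v
      rw [Finset.range_add_one, Finset.filter_insert]
      split_ifs <;> simp

/-- Every non-rootpath vertex is left via its parent port exactly once. -/
theorem card_exits_via_parFinal (P : PortedGraph V) (vR : V) (k : ℕ) (v : V)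
    (hv : v ∈ P.visitedBy vR k) (hvne : v ≠ vR) (hnr : ¬ P.onRootpath vR k v) :
    ((Finset.Icc 1 (P.stopTime vR k - 1)).filter (fun t =>
      ∃ d : PDir,
        P.exitEvent vR (P.trace vR (t - 1)) = some (v, P.parFinal vR k v, d))).card
      = 1 := by
  have hN : P.stopTime vR k ≠ 0 := by
    intro h
    rw [visitedBy, h] at hv
    exact hvne (by simpa [trace] using hv)
  obtain ⟨T, hT⟩ := Nat.exists_eq_succ_of_ne_zero hN
  have hcard : k ≤ (P.trace vR (T + 1)).vis.card := by
    have hne : {t : ℕ | k ≤ ((P.trace vR t).vis).card}.Nonempty :=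
      Nat.nonempty_of_pos_sInf (Nat.pos_of_ne_zero hN)
    have := Nat.sInf_mem hne
    rwa [← stopTime, hT] at this
  have hcard' : (P.trace vR T).vis.card < k := by
    have : T < sInf {t : ℕ | k ≤ ((P.trace vR t).vis).card} := by
      rw [← stopTime, hT]
      exact T.lt_succ_self
    simpa using Nat.notMem_of_lt_sInf this
  obtain ⟨w, q, hpos, hw, hvis, hparw⟩ := P.exists_pos_of_step_vis_ne vR (P.trace vR T)
    (fun h => by rw [trace, h] at hcard; omega)
  change (P.trace vR (T + 1)).vis = _ at hvis
  change (P.trace vR (T + 1)).par w = _ at hparw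
  have hf : P.parFinal vR k = (P.trace vR (T + 1)).par := by rw [parFinal, hT]
  have hV : P.visitedBy vR k = insert w (P.trace vR T).vis := by rw [visitedBy, hT, ← hvis]
  have hlast : P.lastVert vR k = w := by
    have hex : ∃ v : V, v ∈ P.visitedBy vR k ∧ v ∉ (P.trace vR (P.stopTime vR k - 1)).vis :=
      ⟨w, by simp [hV], by simpa [hT] using hw⟩
    rw [lastVert, dif_pos hex]
    obtain ⟨h1, h2⟩ := hex.choose_spec
    generalize hex.choose = x at h1 h2
    rw [hV] at h1
    rw [hT, Nat.succ_sub_one] at h2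
    exact (Finset.mem_insert.1 h1).resolve_right h2
  rcases P.exists_traversalInv vR hf T.le_succ with ⟨x, hx⟩ | ⟨l, hl⟩
  · simp [hx] at hpos
  have hp := hl.pos
  rw [hpos] at hp
  obtain ⟨a, hla, hwa, rfl, hr⟩ := hp
  have hpw : P.IsParent (P.parFinal vR k) w a := ⟨hwa, by rw [hf, hparw]⟩
  have hwne : w ≠ vR := by
    rintro rfl
    exact hw (P.trace_vis_par w T.zero_le (by simp [trace])).1
  have hT' : ∀ x ∈ P.visitedBy vR k, x ≠ vR → ∀ b, P.IsParent (P.parFinal vR k) x b →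
      (P.treeRel vR k).Adj x b := by
    intro x hx hx' b hb
    rw [treeRel, SimpleGraph.fromRel_adj]
    refine ⟨hb.1.ne, .inl ⟨hx, hx', ?_⟩⟩
    rw [parentVert, hb.2, P.dest_port hb.1]
  obtain ⟨p, hps⟩ := hl.stack.exists_walk (T := P.treeRel vR k)
    (fun x hx => hT' x (by rw [hV]; exact Finset.mem_insert_of_mem hx)) hla
  have hwl : w ∉ l := fun h => hw (hl.stack.mem_of_mem w h)
  have hvl : v ∉ w :: l := by
    intro hvl
    have hadj := hT' w (by simp [hV]) hwne a hpw
    refine hnr ?_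
    rw [onRootpath, hlast]
    refine ⟨(SimpleGraph.Walk.cons hadj p).reverse, ?_, ?_⟩
    · rw [SimpleGraph.Walk.isPath_reverse_iff, SimpleGraph.Walk.isPath_def]
      simp [hps, hwl, hl.stack.nodup]
    · rwa [SimpleGraph.Walk.support_reverse, List.mem_reverse, 
        SimpleGraph.Walk.support_cons, hps]
  obtain ⟨hvw, hvl⟩ := not_or.1 (List.mem_cons.not.1 hvl)
  have hvS : v ∈ (P.trace vR T).vis := by
    rw [hV] at hv
    exact (Finset.mem_insert.1 hv).resolve_left hvw
  have hc := hl.count v hvne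
  rw [if_pos ⟨hvS, hvl⟩] at hc
  rw [hT, Nat.succ_sub_one]
  refine Eq.trans ?_ hc
  refine Finset.card_bij' (fun t _ => t - 1) (fun t _ => t + 1) ?_ ?_ ?_ ?_
  · intro t ht
    simp only [Finset.mem_filter, Finset.mem_Icc, Finset.mem_range] at ht ⊢
    exact ⟨by omega, ht.2⟩
  · intro t ht
    simp only [Finset.mem_filter, Finset.mem_Icc, Finset.mem_range] at ht ⊢
    exact ⟨by omega, ht.2⟩
  · intro t ht
    simp only [Finset.mem_filter, Finset.mem_Icc] at ht
    exact Nat.sub_add_cancel ht.1.1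
  · intro t _
    exact Nat.add_sub_cancel t 1

end PortedGraph

/-- for every `2 ≤ k ≤ n`, if `v ∈ V' \ {v_R}` is a non-rootpath
vertex, then during the `k`-stopped port-DFS traversal (whose moves are indexed
`1, …, stopTime - 1`, move `t` being the transition out of the state at time
`t - 1`) the walk leaves `v` via its parent port `par(v)` exactly once. -/
theorem statement5 {V : Type} [Fintype V] [DecidableEq V]
    (P : PortedGraph V) (vR : V) (k : ℕ)
    (hk1 : 2 ≤ k) (hk2 : k ≤ Fintype.card V)
    (v : V) (hv : v ∈ P.visitedBy vR k) (hvne : v ≠ vR)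
    (hnr : ¬ P.onRootpath vR k v) :
    ((Finset.Icc 1 (P.stopTime vR k - 1)).filter (fun t =>
      ∃ d : PDir,
        P.exitEvent vR (P.trace vR (t - 1)) = some (v, P.parFinal vR k v, d))).card
      = 1 := by
  exact P.card_exits_via_parFinal vR k v hv hvne hnr
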